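/- Fix a domain Ω'' ⊂⊂ Ω' and set C_* := 2·osc_{cl Ω'} u + 2 and t₀ := dist²(Ω'', ∂Ω')/(4C_*). For each t ∈ (0,t₀), liminf_{μ→0⁺} ( f_t(x,λ+μ) − f_t(x,λ) )/μ ≥ −e^{−2nkλ}·(nk/t)·L²_{t,λ}(x) for all λ ∈ [0,1) and x ∈ Ω''. Consequently, for each x ∈ Ω'', ∂f_t(x,λ)/∂λ ≥ −e^{−2nkλ}·(nk/t)·L²_{t,λ}(x) for 𝓛¹-almost every λ ∈ (0,1). -/

import Mathlib

open MeasureTheory Metric Filter Set Asymptotics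
open scoped Topology ENNReal NNReal

noncomputable section

namespace Paper

/-- A unit-speed geodesic of length `L`. -/
def IsUnitGeodesic {M : Type*} [MetricSpace M] (γ : ℝ → M) (L : ℝ) : Prop :=
  0 ≤ L ∧ ∀ s ∈ Set.Icc (0:ℝ) L, ∀ t ∈ Set.Icc (0:ℝ) L, dist (γ s) (γ t) = |s - t|

/-- A geodesic metric space: every pair of points is joined by a unit-speed
shortest geodesic. -/
def GeodesicSpace (M : Type*) [MetricSpace M] : Prop :=
  ∀ x y : M, ∃ γ : ℝ → M, IsUnitGeodesic γ (dist x y) ∧ γ 0 = x ∧ γ (dist x y) = y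

/-- The comparison angle `∠̃_k` in the model plane `𝕄²_k` at the vertex between two
sides of lengths `a`, `b` whose opposite side has length `c`, given by the law of
cosines in the model plane of constant curvature `k`. -/
def cmpAngle (k a b c : ℝ) : ℝ :=
  if k = 0 then Real.arccos ((a ^ 2 + b ^ 2 - c ^ 2) / (2 * a * b))
  else if k < 0 then
    Real.arccos ((Real.cosh (Real.sqrt (-k) * a) * Real.cosh (Real.sqrt (-k) * b) -
        Real.cosh (Real.sqrt (-k) * c)) /
      (Real.sinh (Real.sqrt (-k) * a) * Real.sinh (Real.sqrt (-k) * b)))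
  else
    Real.arccos ((Real.cos (Real.sqrt k * c) -
        Real.cos (Real.sqrt k * a) * Real.cos (Real.sqrt k * b)) /
      (Real.sin (Real.sqrt k * a) * Real.sin (Real.sqrt k * b)))

/-- A (complete, locally compact) geodesic space has curvature `≥ k` in the sense of
Alexandrov: near every point, comparison angles along pairs of geodesics issuing from a common
point are non-increasing in each of the two parameters. -/
structure CurvBddBelow (M : Type*) [MetricSpace M] (k : ℝ) : Prop where
  locallyCompact : LocallyCompactSpace M
  geodesic : GeodesicSpace M
  comparison : ∀ x : M, ∃ U ∈ 𝓝 x,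
    ∀ (p : M) (γ σ : ℝ → M) (L₁ L₂ : ℝ),
      IsUnitGeodesic γ L₁ → IsUnitGeodesic σ L₂ →
      (∀ s ∈ Set.Icc (0:ℝ) L₁, γ s ∈ U) → (∀ t ∈ Set.Icc (0:ℝ) L₂, σ t ∈ U) →
      γ 0 = p → σ 0 = p →
      ∀ s t s' t' : ℝ, 0 < s → s ≤ s' → s' ≤ L₁ → 0 < t → t ≤ t' → t' ≤ L₂ →
        cmpAngle k s' t' (dist (γ s') (σ t')) ≤ cmpAngle k s t (dist (γ s) (σ t))

/-- An `n`-dimensional Alexandrov space with curvature `≥ k` (without boundary);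
its Hausdorff dimension equals `n` and it carries the `n`-dimensional Hausdorff
measure `μH[n]` as its volume. -/
structure AlexandrovSpace (M : Type*) [MetricSpace M] (n : ℕ) (k : ℝ) : Prop where
  curv : CurvBddBelow M k
  dim : dimH (Set.univ : Set M) = n

/-- An NPC space: a complete geodesic space which is globally non-positively curved in
the sense of Alexandrov (CAT(0)); the comparison inequality `d(P,S) ≤ |P̄S̄|` for the
midpoint `S` of the side `QR` is expressed through the Euclidean median formula. -/
structure NPCSpace (Y : Type*) [MetricSpace Y] : Prop where
  complete : CompleteSpace Y
  geodesic : GeodesicSpace Y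
  cat0 : ∀ p q r m : Y, dist q m = dist q r / 2 → dist r m = dist q r / 2 →
    dist p m ^ 2 ≤ (dist p q ^ 2 + dist p r ^ 2) / 2 - dist q r ^ 2 / 4

/-- `Lip_0(Ω)`: Lipschitz functions with compact support contained in `Ω`. -/
def IsLip0 {M : Type*} [MetricSpace M] (Ω : Set M) (φ : M → ℝ) : Prop :=
  (∃ c : ℝ≥0, LipschitzWith c φ) ∧ IsCompact (tsupport φ) ∧ tsupport φ ⊆ Ω

/-- `C_0(Ω)`: continuous functions with compact support contained in `Ω`. -/
def IsC0 {M : Type*} [MetricSpace M] (Ω : Set M) (φ : M → ℝ) : Prop :=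
  Continuous φ ∧ IsCompact (tsupport φ) ∧ tsupport φ ⊆ Ω

/-- `A ⊂⊂ B` : `A` is compactly contained in `B`. -/
def CptIn {M : Type*} [TopologicalSpace M] (A B : Set M) : Prop :=
  IsCompact (closure A) ∧ closure A ⊆ B

/-- An abstract first-order Sobolev calculus on the metric measure space `(M, d, μ)`:
it records the Sobolev spaces `W^{1,2}(Ω)`, `W^{1,2}_0(Ω)` and the pointwise inner
product of weak gradients `⟨∇f, ∇g⟩`, with the basic compatibility properties. -/
structure SobolevFramework (M : Type*) [MetricSpace M] [MeasurableSpace M]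
    (μ : Measure M) where
  memW12 : Set M → (M → ℝ) → Prop
  memW12_0 : Set M → (M → ℝ) → Prop
  innerGrad : (M → ℝ) → (M → ℝ) → M → ℝ
  innerGrad_symm : ∀ f g, innerGrad f g = innerGrad g f
  innerGrad_add_left : ∀ f g h, innerGrad (f + g) h = innerGrad f h + innerGrad g h
  innerGrad_smul_left : ∀ (c : ℝ) (f g : M → ℝ),
    innerGrad (fun x => c * f x) g = fun x => c * innerGrad f g x
  innerGrad_nonneg : ∀ f x, 0 ≤ innerGrad f f x
  innerGrad_lip_le : ∀ (f : M → ℝ) (c : ℝ≥0), LipschitzWith c f →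
    ∀ x, innerGrad f f x ≤ (c : ℝ) ^ 2
  lip_memW12 : ∀ (Ω : Set M) (f : M → ℝ), Bornology.IsBounded Ω →
    (∃ c : ℝ≥0, LipschitzWith c f) → memW12 Ω f
  lip0_memW12_0 : ∀ (Ω : Set M) (f : M → ℝ), IsLip0 Ω f → memW12_0 Ω f
  memW12_0_sub : ∀ (Ω : Set M) (f : M → ℝ), memW12_0 Ω f → memW12 Ω f

variable {M : Type*} [MetricSpace M] [MeasurableSpace M] {μ : Measure M}

/-- `f ∈ W^{1,2}_loc(Ω)`. -/
def memW12loc (F : SobolevFramework M μ) (Ω : Set M) (f : M → ℝ) : Prop :=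
  ∀ Ω' : Set M, IsOpen Ω' → CptIn Ω' Ω → F.memW12 Ω' f

/-- `f` is a super-solution of the Poisson equation `𝓛_f = h·vol` on `Ω`:
`𝓛_f(φ) = -∫_Ω ⟨∇f,∇φ⟩ ≤ ∫_Ω hφ` for all nonnegative `φ ∈ Lip_0(Ω)`. -/
def IsSupersolution (F : SobolevFramework M μ) (Ω : Set M) (f h : M → ℝ) : Prop :=
  ∀ φ : M → ℝ, IsLip0 Ω φ → (∀ x, 0 ≤ φ x) →
    -∫ x in Ω, F.innerGrad f φ x ∂μ ≤ ∫ x in Ω, h x * φ x ∂μ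

/-- `f` is a sub-solution of the Poisson equation `𝓛_f = h·vol` on `Ω`. -/
def IsSubsolution (F : SobolevFramework M μ) (Ω : Set M) (f h : M → ℝ) : Prop :=
  ∀ φ : M → ℝ, IsLip0 Ω φ → (∀ x, 0 ≤ φ x) →
    ∫ x in Ω, h x * φ x ∂μ ≤ -∫ x in Ω, F.innerGrad f φ x ∂μ

/-- `f` is a weak solution of `𝓛_f = h·vol` on `Ω`. -/
def IsWeakSolution (F : SobolevFramework M μ) (Ω : Set M) (f h : M → ℝ) : Prop :=
  IsSupersolution F Ω f h ∧ IsSubsolution F Ω f h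

/-- The normalizing constant `c_{n,p} = ∫_{𝕊^{n-1}} |x¹|^p dσ
    = 2 π^{(n-1)/2} Γ((p+1)/2) / Γ((n+p)/2)`. -/
def cnp (n : ℕ) (p : ℝ) : ℝ :=
  2 * Real.pi ^ (((n : ℝ) - 1) / 2) * Real.Gamma ((p + 1) / 2) /
    Real.Gamma (((n : ℝ) + p) / 2)

/-- `ω_{n-1}`, the volume of the standard unit sphere `𝕊^{n-1} ⊂ ℝⁿ`. -/
def sphereVol (n : ℕ) : ℝ := 2 * Real.pi ^ ((n : ℝ) / 2) / Real.Gamma ((n : ℝ) / 2)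

variable {Y : Type*} [MetricSpace Y]

/-- The approximating energy density
`e^u_{p,ε}(x) = ((n+p)/(c_{n,p} ε^{n+p})) ∫_{B_x(ε)∩Ω} d_Y^p(u(x),u(y)) dμ(y)`. -/
def ksDensity (n : ℕ) (p : ℝ) (μ : Measure M) (Ω : Set M) (u : M → Y) (ε : ℝ)
    (x : M) : ℝ :=
  ((n : ℝ) + p) / (cnp n p * ε ^ ((n : ℝ) + p)) *
    ∫ y in Metric.ball x ε ∩ Ω, dist (u x) (u y) ^ p ∂μ

/-- The approximating energy `E^u_{p,ε}(φ) = ∫_Ω φ e^u_{p,ε} dμ`. -/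
def ksApproxEnergy (n : ℕ) (p : ℝ) (μ : Measure M) (Ω : Set M) (u : M → Y)
    (φ : M → ℝ) (ε : ℝ) : ℝ :=
  ∫ x in Ω, φ x * ksDensity n p μ Ω u ε x ∂μ

/-- Membership in the Korevaar-Schoen type Sobolev space `W^{1,p}(Ω,Y)`:
`u ∈ L^p(Ω,Y)` is Borel with separable range, the energy functional
`E^u_p(φ) = lim_{ε→0⁺} E^u_{p,ε}(φ)` exists for every `φ ∈ C_0(Ω)`, and the total
energy `sup {E^u_p(φ) : φ ∈ C_0(Ω), 0 ≤ φ ≤ 1}` is finite. -/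
def MemKS (n : ℕ) (p : ℝ) (μ : Measure M) (Ω : Set M) (u : M → Y) : Prop :=
  (∀ P : Y, Measurable fun x => dist (u x) P) ∧
  TopologicalSpace.IsSeparable (Set.range u) ∧
  (∃ P : Y, IntegrableOn (fun x => dist (u x) P ^ p) Ω μ) ∧
  (∀ φ : M → ℝ, IsC0 Ω φ → ∃ e : ℝ,
    Tendsto (fun ε => ksApproxEnergy n p μ Ω u φ ε) (𝓝[>] (0:ℝ)) (𝓝 e)) ∧
  ∃ C : ℝ, ∀ (φ : M → ℝ) (e : ℝ), IsC0 Ω φ → (∀ x, 0 ≤ φ x ∧ φ x ≤ 1) →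
    Tendsto (fun ε => ksApproxEnergy n p μ Ω u φ ε) (𝓝[>] (0:ℝ)) (𝓝 e) → e ≤ C

/-- The total energy `E^u_p = sup {E^u_p(φ) : φ ∈ C_0(Ω), 0 ≤ φ ≤ 1}`. -/
def ksEnergy (n : ℕ) (p : ℝ) (μ : Measure M) (Ω : Set M) (u : M → Y) : ℝ :=
  sSup { e : ℝ | ∃ φ : M → ℝ, IsC0 Ω φ ∧ (∀ x, 0 ≤ φ x ∧ φ x ≤ 1) ∧
    Tendsto (fun ε => ksApproxEnergy n p μ Ω u φ ε) (𝓝[>] (0:ℝ)) (𝓝 e) }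

/-- `ν` is the (finite Borel) energy measure `E^u_p` of `u` on `Ω`:
`E^u_{p,ε}(φ) → ∫ φ dν` for every nonnegative `φ ∈ C_0(Ω)`. -/
def IsEnergyMeasure (n : ℕ) (p : ℝ) (μ : Measure M) (Ω : Set M) (u : M → Y)
    (ν : Measure M) : Prop :=
  IsFiniteMeasure ν ∧
  ∀ φ : M → ℝ, IsC0 Ω φ → (∀ x, 0 ≤ φ x) →
    Tendsto (fun ε => ksApproxEnergy n p μ Ω u φ ε) (𝓝[>] (0:ℝ)) (𝓝 (∫ x, φ x ∂ν))

/-- `|∇u|_p`, the density of the absolutely continuous part of the energy measure `ν`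
with respect to `μ` (the Radon–Nikodym derivative). -/
def ksDens (μ ν : Measure M) (x : M) : ℝ := (ν.rnDeriv μ x).toReal

/-- `u` is a harmonic map: `u ∈ W^{1,2}(Ω,Y)` minimizes the energy `E^w_2` among all
`w ∈ W^{1,2}(Ω,Y)` with `d_Y(w(·),u(·)) ∈ W^{1,2}_0(Ω)`. -/
def IsHarmonicMap (F : SobolevFramework M μ) (n : ℕ) (Ω : Set M) (u : M → Y) : Prop :=
  MemKS n 2 μ Ω u ∧
  ∀ w : M → Y, MemKS n 2 μ Ω w → F.memW12_0 Ω (fun x => dist (w x) (u x)) →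
    ksEnergy n 2 μ Ω u ≤ ksEnergy n 2 μ Ω w

/-- The oscillation `osc_A u = max_{x,y ∈ A} d_Y(u(x),u(y))`. -/
def oscOn (u : M → Y) (A : Set M) : ℝ :=
  sSup { d : ℝ | ∃ x ∈ A, ∃ y ∈ A, d = dist (u x) (u y) }

/-- The pointwise Lipschitz constant `Lip u(x) = limsup_{y→x} d_Y(u(x),u(y))/|xy|`. -/
def pLipMap (u : M → Y) (x : M) : ℝ :=
  Filter.limsup (fun y => dist (u x) (u y) / dist x y) (𝓝[≠] x)

/-- The volume `vol(Σ_x)` of the space of directions at `x`, recovered as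
`lim_{r→0⁺} n · vol(B_x(r)) / rⁿ`. -/
def dirVolume (μ : Measure M) (n : ℕ) (x : M) : ℝ :=
  limUnder (𝓝[>] (0:ℝ)) (fun r => (n : ℝ) * (μ (Metric.ball x r)).toReal / r ^ n)

/-- The model function `s_k`. -/
def snk (k r : ℝ) : ℝ :=
  if k < 0 then Real.sinh (Real.sqrt (-k) * r) / Real.sqrt (-k)
  else if k = 0 then r
  else Real.sin (Real.sqrt k * r) / Real.sqrt k

/-- The set `M^δ = {x : vol(Σ_x) > (1-δ)·vol(𝕊^{n-1})}` of `δ`-regular points. -/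
def Mdelta (μ : Measure M) (n : ℕ) (δ : ℝ) : Set M :=
  { x : M | (1 - δ) * sphereVol n < dirVolume μ n x }

/-- The auxiliary function
`f_t(x,λ) = inf_{y∈Ω'} { e^{-2nkλ} |xy|²/(2t) - d_Y(u(x),u(y)) }`. -/
def auxF (n : ℕ) (k : ℝ) (u : M → Y) (Ω' : Set M) (t : ℝ) (x : M) (l : ℝ) : ℝ :=
  sInf { v : ℝ | ∃ y ∈ Ω',
    v = Real.exp (-2 * (n : ℝ) * k * l) * dist x y ^ 2 / (2 * t) - dist (u x) (u y) }

/-- The set `S_t(x,λ)` of points realizing the infimum defining `f_t(x,λ)`. -/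
def auxS (n : ℕ) (k : ℝ) (u : M → Y) (Ω' : Set M) (t : ℝ) (l : ℝ) (x : M) : Set M :=
  { y ∈ Ω' | auxF n k u Ω' t x l
      = Real.exp (-2 * (n : ℝ) * k * l) * dist x y ^ 2 / (2 * t) - dist (u x) (u y) }

/-- `L_{t,λ}(x) = dist(x, S_t(x,λ))`. -/
def auxL (n : ℕ) (k : ℝ) (u : M → Y) (Ω' : Set M) (t : ℝ) (l : ℝ) (x : M) : ℝ :=
  Metric.infDist x (auxS n k u Ω' t l x)

/-- Distance between two sets. -/
def setDist (A B : Set M) : ℝ := sInf { d : ℝ | ∃ x ∈ A, ∃ y ∈ B, d = dist x y }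

/-- `g` is a (weak) super-solution of the heat equation `𝓛_g = ∂g/∂λ` on the parabolic
cylinder `Q = G×I`: `-∫_Q ⟨∇g,∇φ⟩ dν ≤ ∫_Q (∂g/∂λ)φ dν` for all nonnegative
`φ ∈ Lip_0(Q)`, with `ν = μ × 𝓛¹` and spatial weak gradients. -/
def IsHeatSupersolution (F : SobolevFramework M μ) (G : Set M) (I : Set ℝ)
    (g : M × ℝ → ℝ) : Prop :=
  ∀ φ : M × ℝ → ℝ, IsLip0 (G ×ˢ I) φ → (∀ z, 0 ≤ φ z) →
    -∫ z in G ×ˢ I, F.innerGrad (fun x => g (x, z.2)) (fun x => φ (x, z.2)) z.1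
        ∂(μ.prod volume) ≤
      ∫ z in G ×ˢ I, deriv (fun s => g (z.1, s)) z.2 * φ z ∂(μ.prod volume)

/-- `g` is a (weak) sub-solution of the heat equation `𝓛_g = ∂g/∂λ` on `Q = G×I`. -/
def IsHeatSubsolution (F : SobolevFramework M μ) (G : Set M) (I : Set ℝ)
    (g : M × ℝ → ℝ) : Prop :=
  ∀ φ : M × ℝ → ℝ, IsLip0 (G ×ˢ I) φ → (∀ z, 0 ≤ φ z) →
    ∫ z in G ×ˢ I, deriv (fun s => g (z.1, s)) z.2 * φ z ∂(μ.prod volume) ≤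
      -∫ z in G ×ˢ I, F.innerGrad (fun x => g (x, z.2)) (fun x => φ (x, z.2)) z.1
        ∂(μ.prod volume)

/-- `|∇⁺v|(x) = limsup_{r→0} sup_{y∈B_x(r)} (v(y)-v(x))_+ / r`. -/
def upGrad (v : M → ℝ) (x : M) : ℝ :=
  Filter.limsup
    (fun r => sSup { d : ℝ | ∃ y ∈ Metric.ball x r, d = max (v y - v x) 0 / r })
    (𝓝[>] (0:ℝ))

end Paper

namespace Paper

section

variable {M : Type*} [MetricSpace M] {Y : Type*} [MetricSpace Y]

/-- A minimum over a fixed set of functions that increase with the parameter increases. -/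
lemma monotoneOn_of_isLeast_exp {X : Type*} {K : Set X} {p w : X → ℝ} {c : ℝ} {f : ℝ → ℝ}
    (hc : 0 ≤ c) (hp : ∀ y, 0 ≤ p y)
    (hf : ∀ l, 0 ≤ l → IsLeast ((fun y => Real.exp (c * l) * p y - w y) '' K) (f l)) :
    MonotoneOn f (Set.Ici 0) := by
  intro a ha b hb hab
  obtain ⟨y, hy, hfy⟩ := (hf b hb).1
  rw [← hfy]
  refine ((hf a ha).2 (mem_image_of_mem _ hy)).trans ?_
  have := hp y
  dsimp only
  gcongr

lemma tendsto_exp_sub_exp_div (c l q : ℝ) :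
    Tendsto (fun m => (Real.exp (c * (l + m)) - Real.exp (c * l)) * q / m) (𝓝[>] 0)
      (𝓝 (c * Real.exp (c * l) * q)) := by
  have h : HasDerivAt (fun s => Real.exp (c * s) * q) (Real.exp (c * l) * (c * 1) * q) l :=
    (((hasDerivAt_id l).const_mul c).exp).mul_const q
  rw [mul_one, mul_comm (Real.exp _) c] at h
  refine h.tendsto_slope_zero_right.congr fun m => ?_
  rw [smul_eq_mul]
  ring

/-- Minimizers at parameters slightly larger than `l` cannot have `p` much below its
lower bound `b` over the minimizers at `l`. -/
lemma eventually_le_diffQuot_of_isLeast_exp {X : Type*} [TopologicalSpace X] {K : Set X}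
    {p w : X → ℝ} {c l b r : ℝ} {f : ℝ → ℝ} (hK : IsCompact K)
    (hpc : Continuous p) (hwK : ContinuousOn w K) (hc : 0 ≤ c) (hl : 0 ≤ l)
    (hp : ∀ y, 0 ≤ p y)
    (hf : ∀ l, 0 ≤ l → IsLeast ((fun y => Real.exp (c * l) * p y - w y) '' K) (f l))
    (hb : ∀ y ∈ K, f l = Real.exp (c * l) * p y - w y → b ≤ p y) (hr : r < b) :
    ∀ᶠ m in 𝓝[>] (0 : ℝ), c * Real.exp (c * l) * r ≤ (f (l + m) - f l) / m := by
  have hlow : ∃ δ > 0, ∀ y ∈ K, p y ≤ r → f l + δ ≤ Real.exp (c * l) * p y - w y := by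
    rcases (K ∩ {y | p y ≤ r}).eq_empty_or_nonempty with he | hne
    · exact ⟨1, one_pos, fun y hy hyr => absurd (he ▸ ⟨hy, hyr⟩ : y ∈ (∅ : Set X)) id⟩
    · obtain ⟨y, ⟨hyK, hyr⟩, hmin⟩ :=
        (hK.inter_right (isClosed_le hpc continuous_const)).exists_isMinOn hne
          (f := fun y => Real.exp (c * l) * p y - w y)
          (((hpc.const_mul _).continuousOn.sub hwK).mono inter_subset_left)
      refine ⟨Real.exp (c * l) * p y - w y - f l, sub_pos.2 ?_, fun z hz hzr => ?_⟩
      · refine lt_of_le_of_ne ((hf l hl).2 (mem_image_of_mem _ hyK)) fun h => ?_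
        exact absurd (hb y hyK h) (not_le.2 (lt_of_le_of_lt hyr hr))
      · have := hmin (show z ∈ K ∩ {y | p y ≤ r} from ⟨hz, hzr⟩)
        simp only [mem_ofPred_eq] at this
        linarith
  obtain ⟨δ, hδ, hlow⟩ := hlow
  obtain ⟨y₀, hy₀, hfy₀⟩ := (hf l hl).1
  have hcont : Tendsto (fun m => Real.exp (c * (l + m)) * p y₀ - w y₀) (𝓝[>] 0) (𝓝 (f l)) := by
    have : Continuous fun m : ℝ => Real.exp (c * (l + m)) * p y₀ - w y₀ := by fun_prop
    have h0 := this.tendsto 0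
    rw [add_zero] at h0
    exact hfy₀ ▸ h0.mono_left nhdsWithin_le_nhds
  filter_upwards [hcont.eventually_lt_const (lt_add_of_pos_right (f l) hδ),
    self_mem_nhdsWithin] with m hm hm0
  have hm0 : 0 < m := hm0
  obtain ⟨y, hy, hfy⟩ := (hf (l + m) (by linarith)).1
  have hfy' : f (l + m) ≤ _ := (hf (l + m) (by linarith)).2 (mem_image_of_mem _ hy₀)
  have hfl : f l ≤ _ := (hf l hl).2 (mem_image_of_mem _ hy)
  have hexp : Real.exp (c * l) * (c * m) ≤ Real.exp (c * (l + m)) - Real.exp (c * l) := by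
    rw [mul_add, Real.exp_add]
    nlinarith [Real.add_one_le_exp (c * m), Real.exp_pos (c * l)]
  have hincr : 0 ≤ Real.exp (c * l) * (c * m) := by positivity
  have hpr : r < p y := by
    by_contra! hle
    nlinarith [hlow y hy hle, mul_nonneg (hincr.trans hexp) (hp y)]
  rw [le_div_iff₀ hm0]
  nlinarith [mul_le_mul_of_nonneg_right hexp (hp y), mul_le_mul_of_nonneg_left hpr.le hincr]

lemma le_liminf_diffQuot_of_isLeast_exp {X : Type*} [TopologicalSpace X] {K : Set X}
    {p w : X → ℝ} {c l b : ℝ} {f : ℝ → ℝ} (hK : IsCompact K)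
    (hpc : Continuous p) (hwK : ContinuousOn w K) (hc : 0 ≤ c) (hl : 0 ≤ l)
    (hp : ∀ y, 0 ≤ p y)
    (hf : ∀ l, 0 ≤ l → IsLeast ((fun y => Real.exp (c * l) * p y - w y) '' K) (f l))
    (hb : ∀ y ∈ K, f l = Real.exp (c * l) * p y - w y → b ≤ p y) :
    c * Real.exp (c * l) * b ≤
      Filter.liminf (fun m => (f (l + m) - f l) / m) (𝓝[>] (0 : ℝ)) := by
  have hcob : IsCoboundedUnder (· ≥ ·) (𝓝[>] (0 : ℝ)) (fun m => (f (l + m) - f l) / m) := by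
    obtain ⟨y, hy, hfy⟩ := (hf l hl).1
    refine IsBoundedUnder.isCoboundedUnder_ge ?_
    refine (tendsto_exp_sub_exp_div c l (p y)).isBoundedUnder_le.mono_le ?_
    filter_upwards [self_mem_nhdsWithin] with m hm
    have hm : 0 < m := hm
    have hfm : f (l + m) ≤ _ := (hf (l + m) (by linarith)).2 (mem_image_of_mem _ hy)
    gcongr
    linarith
  have hlim : Tendsto (fun r => c * Real.exp (c * l) * r) (𝓝[<] b)
      (𝓝 (c * Real.exp (c * l) * b)) :=
    ((continuous_const_mul _).tendsto b).mono_left nhdsWithin_le_nhds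
  refine le_of_tendsto hlim ?_
  filter_upwards [self_mem_nhdsWithin] with r hr
  exact le_liminf_of_le hcob
    (eventually_le_diffQuot_of_isLeast_exp hK hpc hwK hc hl hp hf hb hr)

lemma dist_le_oscOn {u : M → Y} {A : Set M} (hA : IsCompact A) (hu : ContinuousOn u A)
    {x y : M} (hx : x ∈ A) (hy : y ∈ A) : dist (u x) (u y) ≤ oscOn u A := by
  obtain ⟨C, hC⟩ := Metric.isBounded_iff.1 (hA.image_of_continuousOn hu).isBounded
  refine le_csSup ⟨C, ?_⟩ ⟨x, hx, y, hy, rfl⟩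
  rintro _ ⟨a, ha, b, hb, rfl⟩
  exact hC (mem_image_of_mem u ha) (mem_image_of_mem u hb)

lemma setDist_nonneg (A B : Set M) : 0 ≤ setDist A B :=
  Real.sInf_nonneg (by rintro _ ⟨x, _, y, _, rfl⟩; exact dist_nonneg)

lemma setDist_le_dist {A B : Set M} {x y : M} (hx : x ∈ A) (hy : y ∈ B) :
    setDist A B ≤ dist x y :=
  csInf_le ⟨0, by rintro _ ⟨a, _, b, _, rfl⟩; exact dist_nonneg⟩ ⟨x, hx, y, hy, rfl⟩

/-- Points of `closure G` whose penalized value does not exceed the value `0` attained at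
`x ∈ A` lie in `G`, when `t` is small. -/
lemma mem_of_penalized_nonpos {u : M → Y} {A G : Set M} (hG : IsOpen G)
    (hGc : IsCompact (closure G)) (hu : ContinuousOn u (closure G)) {t a : ℝ} (ht : 0 < t)
    (ht' : t < setDist A (frontier G) ^ 2 / (4 * (2 * oscOn u (closure G) + 2)))
    (ha : 1 ≤ a) {x y : M} (hxA : x ∈ A) (hx : x ∈ closure G) (hy : y ∈ closure G)
    (hxy : a * (dist x y ^ 2 / (2 * t)) - dist (u x) (u y) ≤ 0) : y ∈ G := by
  by_contra hyG
  have hD := setDist_le_dist hxA (show y ∈ frontier G by rw [hG.frontier_eq]; exact ⟨hy, hyG⟩)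
  have hD2 : setDist A (frontier G) ^ 2 ≤ dist x y ^ 2 :=
    pow_le_pow_left₀ (setDist_nonneg _ _) hD 2
  have hosc := dist_le_oscOn hGc hu hx hy
  have hosc0 := dist_nonneg.trans hosc
  rw [lt_div_iff₀ (by positivity)] at ht'
  have hq : dist x y ^ 2 / (2 * t) ≤ oscOn u (closure G) := by
    nlinarith [show 0 ≤ dist x y ^ 2 / (2 * t) by positivity]
  rw [div_le_iff₀ (by positivity)] at hq
  nlinarith [mul_nonneg hosc0 ht.le]

/-- For small `t`, the infimum defining `auxF` is a minimum over `closure G`. -/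
lemma isLeast_auxF {n : ℕ} {k : ℝ} (hk : k ≤ 0) {u : M → Y} {A G : Set M} (hG : IsOpen G)
    (hGc : IsCompact (closure G)) (hu : ContinuousOn u (closure G)) {t : ℝ} (ht : 0 < t)
    (ht' : t < setDist A (frontier G) ^ 2 / (4 * (2 * oscOn u (closure G) + 2)))
    {x : M} (hxA : x ∈ A) (hx : x ∈ closure G) {l : ℝ} (hl : 0 ≤ l) :
    IsLeast ((fun y => Real.exp (-2 * (n : ℝ) * k * l) * (dist x y ^ 2 / (2 * t))
      - dist (u x) (u y)) '' closure G) (auxF n k u G t x l) := by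
  set g : M → ℝ := fun y => Real.exp (-2 * (n : ℝ) * k * l) * (dist x y ^ 2 / (2 * t))
      - dist (u x) (u y) with hg
  have ha : 1 ≤ Real.exp (-2 * (n : ℝ) * k * l) :=
    Real.one_le_exp (mul_nonneg (by nlinarith [n.cast_nonneg (α := ℝ)]) hl)
  have hgc : ContinuousOn g (closure G) := by
    refine ContinuousOn.sub (Continuous.continuousOn (by fun_prop)) ?_
    exact continuous_dist.comp_continuousOn (continuousOn_const.prodMk hu)
  obtain ⟨y, hy, hmin⟩ := hGc.exists_isMinOn ⟨x, hx⟩ hgc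
  have hgx : g x = 0 := by simp [hg]
  have hyG : y ∈ G :=
    mem_of_penalized_nonpos hG hGc hu ht ht' ha hxA hx hy ((hmin hx).trans_eq hgx)
  have hF : auxF n k u G t x l = g y := by
    refine IsLeast.csInf_eq ⟨⟨y, hyG, by simp only [hg, mul_div_assoc]⟩, ?_⟩
    rintro _ ⟨z, hz, rfl⟩
    rw [mul_div_assoc]
    exact hmin (subset_closure hz)
  rw [hF]
  exact ⟨mem_image_of_mem g hy, forall_mem_image.2 fun z hz => hmin hz⟩

end

/-- Lemma 6.3. For `Ω'' ⊂⊂ Ω'`, `C_* = 2 osc_{cl Ω'} u + 2`,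
`t₀ = dist²(Ω'',∂Ω')/(4C_*)` and `t ∈ (0,t₀)`:
`liminf_{μ→0⁺} (f_t(x,λ+μ)-f_t(x,λ))/μ ≥ -e^{-2nkλ}(nk/t)L²_{t,λ}(x)` for all
`λ ∈ [0,1)`, `x ∈ Ω''`; consequently `∂f_t(x,λ)/∂λ ≥ -e^{-2nkλ}(nk/t)L²_{t,λ}(x)` for
each `x ∈ Ω''` and `𝓛¹`-a.e. `λ ∈ (0,1)`. -/
theorem statement_13 (n : ℕ) (k : ℝ) (hk : k ≤ 0)
    {M : Type*} [MetricSpace M] [MeasurableSpace M] [BorelSpace M]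
    (hM : AlexandrovSpace M n k)
    {Y : Type*} [MetricSpace Y] (hY : NPCSpace Y)
    (F : SobolevFramework M (μH[(n : ℝ)]))
    (Ω Ω' Ω'' : Set M)
    (hΩo : IsOpen Ω) (hΩc : IsConnected Ω) (hΩb : Bornology.IsBounded Ω)
    (hΩ'o : IsOpen Ω') (hΩ'c : IsConnected Ω') (hΩ' : CptIn Ω' Ω)
    (hΩ''o : IsOpen Ω'') (hΩ''c : IsConnected Ω'') (hΩ'' : CptIn Ω'' Ω')
    (u : M → Y) (hu : ContinuousOn u Ω) (hharm : IsHarmonicMap F n Ω u)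
    (Cstar t₀ : ℝ)
    (hC : Cstar = 2 * oscOn u (closure Ω') + 2)
    (ht₀ : t₀ = setDist Ω'' (frontier Ω') ^ 2 / (4 * Cstar))
    (t : ℝ) (ht : 0 < t) (ht' : t < t₀) :
    (∀ l ∈ Set.Ico (0:ℝ) 1, ∀ x ∈ Ω'',
      -(Real.exp (-2 * (n : ℝ) * k * l) * ((n : ℝ) * k / t)
          * auxL n k u Ω' t l x ^ 2) ≤
        Filter.liminf
          (fun m => (auxF n k u Ω' t x (l + m) - auxF n k u Ω' t x l) / m)
          (𝓝[>] (0:ℝ))) ∧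
    ∀ x ∈ Ω'', ∀ᵐ l ∂(volume.restrict (Set.Ioo (0:ℝ) 1)),
      -(Real.exp (-2 * (n : ℝ) * k * l) * ((n : ℝ) * k / t)
          * auxL n k u Ω' t l x ^ 2) ≤
        deriv (fun s => auxF n k u Ω' t x s) l := by
  subst hC ht₀
  have huK : ContinuousOn u (closure Ω') := hu.mono hΩ'.2
  have hc : 0 ≤ -2 * (n : ℝ) * k := by nlinarith [n.cast_nonneg (α := ℝ)]
  have hmem : ∀ x ∈ Ω'', x ∈ closure Ω' := fun x hx =>
    subset_closure (hΩ''.2 (subset_closure hx))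
  have hleast : ∀ x ∈ Ω'', ∀ l, 0 ≤ l → IsLeast ((fun y => Real.exp (-2 * (n : ℝ) * k * l) *
      (dist x y ^ 2 / (2 * t)) - dist (u x) (u y)) '' closure Ω') (auxF n k u Ω' t x l) :=
    fun x hx l hl => isLeast_auxF hk hΩ'o hΩ'.1 huK ht ht' hx (hmem x hx) hl
  have hliminf : ∀ l, 0 ≤ l → ∀ x ∈ Ω'',
      -(Real.exp (-2 * (n : ℝ) * k * l) * ((n : ℝ) * k / t) * auxL n k u Ω' t l x ^ 2) ≤
        Filter.liminf (fun m => (auxF n k u Ω' t x (l + m) - auxF n k u Ω' t x l) / m)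
          (𝓝[>] (0:ℝ)) := by
    intro l hl x hx
    have h := le_liminf_diffQuot_of_isLeast_exp (b := auxL n k u Ω' t l x ^ 2 / (2 * t))
      (p := fun y => dist x y ^ 2 / (2 * t)) (w := fun y => dist (u x) (u y))
      hΩ'.1 (by fun_prop)
      (continuous_dist.comp_continuousOn (continuousOn_const.prodMk huK)) hc hl
      (fun y => by positivity) (hleast x hx) ?_
    · refine le_of_eq_of_le ?_ h
      field_simp
    · intro y hy hFy
      have hy0 : Real.exp (-2 * (n : ℝ) * k * l) * (dist x y ^ 2 / (2 * t))
          - dist (u x) (u y) ≤ 0 := by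
        rw [← hFy]
        simpa using (hleast x hx l hl).2 (mem_image_of_mem _ (hmem x hx))
      have hyΩ : y ∈ Ω' := mem_of_penalized_nonpos hΩ'o hΩ'.1 huK ht ht'
        (Real.one_le_exp (mul_nonneg hc hl)) hx (hmem x hx) hy hy0
      have hyS : y ∈ auxS n k u Ω' t l x := ⟨hyΩ, by rw [hFy, mul_div_assoc]⟩
      have hL : auxL n k u Ω' t l x ≤ dist x y := infDist_le_dist_of_mem hyS
      have hL0 : 0 ≤ auxL n k u Ω' t l x := infDist_nonneg
      gcongr
  refine ⟨fun l hl => hliminf l hl.1, fun x hx => ?_⟩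
  have hmono : MonotoneOn (fun s => auxF n k u Ω' t x s) (Set.Ioo 0 1) :=
    (monotoneOn_of_isLeast_exp hc (fun y => by positivity) (hleast x hx)).mono
      fun s hs => hs.1.le
  filter_upwards [hmono.ae_differentiableWithinAt measurableSet_Ioo,
    ae_restrict_mem measurableSet_Ioo] with l hd hl
  have hder := (hd.differentiableAt (isOpen_Ioo.mem_nhds hl)).hasDerivAt
  refine (hliminf l hl.1.le x hx).trans_eq (Tendsto.liminf_eq ?_)
  refine hder.tendsto_slope_zero_right.congr fun m => ?_
  rw [smul_eq_mul, div_eq_inv_mul]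

end Paper
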